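/- Let m ≥ 4 be an even integer. Then there exists a unique ω > 0 satisfying sinh(ω/2)²·sinh(m·ω/2)·(sinh((m+2)·ω/2) − sinh(m·ω/2)) = sinh(ω)·sinh((m+1)·ω/2)·sinh(m·ω/4)·sinh((m−2)·ω/4), and for every real s > 0 the Crank–Nicolson matrix satisfies ‖A_m(s)‖_∞ ≤ 1 if and only if s ≤ 1/(cosh(ω) − 1). -/

import Mathlib

open Real Matrix Filter

noncomputable section

/-- Tridiagonal 0/1 matrix with ones on the sub- and super-diagonal. -/
def triMat (m : ℕ) : Matrix (Fin m) (Fin m) ℝ :=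
  fun i j => if (i : ℤ) - (j : ℤ) = 1 ∨ (j : ℤ) - (i : ℤ) = 1 then 1 else 0

/-- Crank–Nicolson iteration matrix `A_m(s)`. -/
def cnMat (m : ℕ) (s : ℝ) : Matrix (Fin m) (Fin m) ℝ :=
  ((1 + s) • (1 : Matrix (Fin m) (Fin m) ℝ) - (s / 2) • triMat m)⁻¹ *
    ((1 - s) • (1 : Matrix (Fin m) (Fin m) ℝ) + (s / 2) • triMat m)

/-- Maximum (row-sum) norm of a square matrix: max over rows of the sum of absolute values. -/
def maxNorm {m : ℕ} (A : Matrix (Fin m) (Fin m) ℝ) : ℝ :=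
  ⨆ i, ∑ j, |A i j|

/-- Chebyshev polynomials of the second kind. -/
def polyU : ℕ → Polynomial ℝ
  | 0 => 1
  | 1 => 2 * Polynomial.X
  | n + 2 => 2 * Polynomial.X * polyU (n + 1) - polyU n

/-- Polynomials `P_n`. -/
def polyP : ℕ → Polynomial ℝ
  | 0 => -1
  | 1 => 2 * Polynomial.X - 4
  | n + 2 => 2 * Polynomial.X * polyP (n + 1) - polyP n

/-- Polynomials `C_n`. -/
def polyC : ℕ → Polynomial ℝ
  | 0 => 0
  | 1 => 4 * (Polynomial.X - 1)
  | n + 2 => 2 * Polynomial.X * polyC (n + 1) - polyC n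

/-- The equation `coth(mω)·sinh(ω) = 3·cosh(ω) − 4`. -/
def cothEq (m : ℕ) (ω : ℝ) : Prop :=
  Real.cosh (m * ω) / Real.sinh (m * ω) * Real.sinh ω = 3 * Real.cosh ω - 4

/-- The contractivity equation for odd `m`. -/
def oddEq (m : ℕ) (ω : ℝ) : Prop :=
  2 * Real.sinh (((m : ℝ) - 1) * ω / 4) * Real.sinh (((m : ℝ) + 1) * ω / 4) =
    Real.sinh (ω / 2) * Real.sinh (((m : ℝ) + 1) * ω / 2)

/-- The contractivity equation for even `m`. -/
def evenEq (m : ℕ) (ω : ℝ) : Prop :=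
  Real.sinh (ω / 2) ^ 2 * Real.sinh ((m : ℝ) * ω / 2) *
      (Real.sinh (((m : ℝ) + 2) * ω / 2) - Real.sinh ((m : ℝ) * ω / 2)) =
    Real.sinh ω * Real.sinh (((m : ℝ) + 1) * ω / 2) * Real.sinh ((m : ℝ) * ω / 4) *
      Real.sinh (((m : ℝ) - 2) * ω / 4)

/-- The rational function with `sinh (k * h) * cosh h = tanhRatio k (tanh h ^ 2) * cosh (k * h) * sinh h`. -/
def tanhRatio : ℕ → ℝ → ℝ
  | 0, _ => 0
  | k + 1, u => (tanhRatio k u + 1) / (1 + u * tanhRatio k u)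

lemma tanhRatio_nonneg {u : ℝ} (hu : 0 ≤ u) : ∀ k, 0 ≤ tanhRatio k u
  | 0 => le_rfl
  | k + 1 => by
    have := tanhRatio_nonneg hu k
    rw [tanhRatio]
    positivity

lemma tanhRatio_zero_right (k : ℕ) : tanhRatio k 0 = k := by
  induction k with
  | zero => simp [tanhRatio]
  | succ k ih => simp [tanhRatio, ih]

lemma tanhRatio_one_right (k : ℕ) : tanhRatio (k + 1) 1 = 1 := by
  induction k with
  | zero => simp [tanhRatio]
  | succ k ih => rw [tanhRatio, ih]; norm_num

lemma continuousOn_tanhRatio (k : ℕ) : ContinuousOn (tanhRatio k) (Set.Icc 0 1) := by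
  induction k with
  | zero => exact continuousOn_const
  | succ k ih =>
    refine (ih.add continuousOn_const).div
      (continuousOn_const.add (continuousOn_id.mul ih)) fun u hu => ?_
    have := mul_nonneg hu.1 (tanhRatio_nonneg hu.1 k)
    linarith

lemma tanhRatio_step_lt {u v a b : ℝ} (hu : 0 ≤ u) (huv : u < v) (hv : v < 1) (ha : 0 < a)
    (hab : a ≤ b) : (a + 1) / (1 + v * a) < (b + 1) / (1 + u * b) := by
  have hb : 0 < b := ha.trans_le hab
  have hv0 : 0 ≤ v := hu.trans huv.le
  rw [div_lt_div_iff₀ (by positivity) (by positivity)]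
  have h₁ : 0 ≤ (b - a) * (1 - v) :=
    mul_nonneg (sub_nonneg.2 hab) (sub_nonneg.2 hv.le)
  have h₂ : 0 < (v - u) * (b * (a + 1)) := mul_pos (sub_pos.2 huv) (by positivity)
  nlinarith

lemma tanhRatio_pos {u : ℝ} (hu : 0 ≤ u) (k : ℕ) : 0 < tanhRatio (k + 1) u := by
  have := tanhRatio_nonneg hu k
  rw [tanhRatio]
  positivity

lemma tanhRatio_le {u v : ℝ} (hu : 0 ≤ u) (huv : u < v) (hv : v < 1) (k : ℕ) :
    tanhRatio (k + 1) v ≤ tanhRatio (k + 1) u := by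
  induction k with
  | zero => simp [tanhRatio]
  | succ k ih =>
    exact (tanhRatio_step_lt hu huv hv (tanhRatio_pos (hu.trans huv.le) k) ih).le

lemma tanhRatio_lt {u v : ℝ} (hu : 0 ≤ u) (huv : u < v) (hv : v < 1) (k : ℕ) :
    tanhRatio (k + 2) v < tanhRatio (k + 2) u :=
  tanhRatio_step_lt hu huv hv (tanhRatio_pos (hu.trans huv.le) k) (tanhRatio_le hu huv hv k)

lemma sinh_mul_cosh_eq_tanhRatio (h : ℝ) (k : ℕ) :
    sinh (k * h) * cosh h = tanhRatio k (tanh h ^ 2) * cosh (k * h) * sinh h := by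
  induction k with
  | zero => simp [tanhRatio]
  | succ k ih =>
    have hR := tanhRatio_nonneg (sq_nonneg (tanh h)) k
    have hc := cosh_pos h
    have hd : 0 < 1 + tanh h ^ 2 * tanhRatio k (tanh h ^ 2) := by positivity
    rw [tanhRatio, Nat.cast_succ, add_one_mul, sinh_add, cosh_add]
    generalize tanhRatio k (tanh h ^ 2) = R at *
    rw [tanh_eq_sinh_div_cosh] at *
    have hS : sinh (k * h) = R * cosh (k * h) * sinh h / cosh h := by
      rw [← ih]; field_simp
    rw [hS]
    field_simp

/-- Its sign decides whether the middle row of the Crank–Nicolson matrix of size `2 * n` has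
absolute sum at most one. -/
def rowGap (n : ℕ) (h : ℝ) : ℝ :=
  cosh h * sinh ((2 * n + 1) * h) - 2 * sinh h * (cosh ((2 * n + 1) * h) + cosh h)

lemma rowGap_eq (n : ℕ) (h : ℝ) :
    rowGap n h = (tanhRatio (n + 1) (tanh h ^ 2) + tanhRatio n (tanh h ^ 2) - 4) *
      (sinh h * cosh ((n + 1 : ℕ) * h) * cosh (n * h)) := by
  have h₁ := sinh_mul_cosh_eq_tanhRatio h n
  have h₂ := sinh_mul_cosh_eq_tanhRatio h (n + 1)
  have e₁ : (2 * n + 1) * h = ((n + 1 : ℕ) : ℝ) * h + n * h := by push_cast; ring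
  have e₂ : cosh h = cosh (((n + 1 : ℕ) : ℝ) * h - n * h) := by
    congr 1; push_cast; ring
  have e₃ : cosh (((n + 1 : ℕ) : ℝ) * h + n * h) + cosh h =
      2 * cosh ((n + 1 : ℕ) * h) * cosh (n * h) := by
    rw [e₂, cosh_add, cosh_sub]; ring
  rw [rowGap, e₁, e₃, sinh_add]
  linear_combination cosh (n * h) * h₂ + cosh ((n + 1 : ℕ) * h) * h₁

lemma evenEq_iff_rowGap {n : ℕ} (hn : 2 ≤ n) {h : ℝ} (hh : 0 < h) :
    evenEq (n + n) (2 * h) ↔ rowGap n h = 0 := by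
  have hn0 : (0 : ℝ) < n := by positivity
  have key : sinh (2 * h) * sinh ((((n + n : ℕ) : ℝ) + 1) * (2 * h) / 2) *
        sinh (((n + n : ℕ) : ℝ) * (2 * h) / 4) * sinh ((((n + n : ℕ) : ℝ) - 2) * (2 * h) / 4) -
      sinh (2 * h / 2) ^ 2 * sinh (((n + n : ℕ) : ℝ) * (2 * h) / 2) *
        (sinh ((((n + n : ℕ) : ℝ) + 2) * (2 * h) / 2) - sinh (((n + n : ℕ) : ℝ) * (2 * h) / 2)) =
      rowGap n h * (2 * sinh h * sinh (n * h) * sinh (n * h + h)) := by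
    have a₁ : (((n + n : ℕ) : ℝ) + 1) * (2 * h) / 2 = n * h + n * h + h := by push_cast; ring
    have a₂ : ((n + n : ℕ) : ℝ) * (2 * h) / 4 = n * h := by push_cast; ring
    have a₃ : (((n + n : ℕ) : ℝ) - 2) * (2 * h) / 4 = n * h - h := by push_cast; ring
    have a₄ : ((n + n : ℕ) : ℝ) * (2 * h) / 2 = n * h + n * h := by push_cast; ring
    have a₅ : (((n + n : ℕ) : ℝ) + 2) * (2 * h) / 2 = n * h + n * h + (h + h) := by
      push_cast; ring
    have a₆ : 2 * h / 2 = h := by ring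
    have a₇ : (2 * (n : ℝ) + 1) * h = n * h + n * h + h := by ring
    rw [rowGap, a₁, a₂, a₃, a₄, a₅, a₆, a₇, two_mul h]
    generalize (n : ℝ) * h = b
    simp only [sinh_eq, cosh_eq, neg_add, sub_eq_add_neg, exp_add, exp_neg, inv_inv]
    field_simp
    ring
  have hpos : 0 < 2 * sinh h * sinh (n * h) * sinh (n * h + h) := by
    have h₁ := sinh_pos_iff.2 hh
    have h₂ := sinh_pos_iff.2 (mul_pos hn0 hh)
    have h₃ := sinh_pos_iff.2 (add_pos (mul_pos hn0 hh) hh)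
    positivity
  unfold evenEq
  rw [eq_comm, ← sub_eq_zero, key, mul_eq_zero, or_iff_left hpos.ne']

lemma exists_rowGap_eq_zero {n : ℕ} (hn : 2 ≤ n) : ∃ h, 0 < h ∧ rowGap n h = 0 := by
  obtain ⟨k, rfl⟩ := Nat.exists_eq_add_of_le' hn
  have hcont : ContinuousOn (fun u => tanhRatio (k + 2 + 1) u + tanhRatio (k + 2) u)
      (Set.Icc 0 1) := (continuousOn_tanhRatio _).add (continuousOn_tanhRatio _)
  have hmem : (4 : ℝ) ∈ Set.Ioo (tanhRatio (k + 2 + 1) 1 + tanhRatio (k + 2) 1)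
      (tanhRatio (k + 2 + 1) 0 + tanhRatio (k + 2) 0) := by
    rw [tanhRatio_zero_right, tanhRatio_zero_right, tanhRatio_one_right, tanhRatio_one_right]
    have : (0 : ℝ) ≤ k := k.cast_nonneg
    constructor
    · norm_num
    · push_cast; linarith
  obtain ⟨u, ⟨hu0, hu1⟩, hu⟩ := intermediate_value_Ioo' zero_le_one hcont hmem
  have hu1' : 0 < 1 - u := sub_pos.2 hu1
  have hd : 0 < u / (1 - u) := div_pos hu0 hu1'
  refine ⟨arsinh √(u / (1 - u)), arsinh_pos_iff.2 (sqrt_pos.2 hd), ?_⟩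
  have ht : tanh (arsinh √(u / (1 - u))) ^ 2 = u := by
    rw [tanh_eq_sinh_div_cosh, div_pow, cosh_sq, sinh_arsinh, sq_sqrt hd.le]
    field_simp
    ring
  rw [rowGap_eq, ht]
  simp only at hu
  rw [hu, sub_self, zero_mul]

lemma tanh_sq_lt_tanh_sq {a b : ℝ} (ha : 0 < a) (hab : a < b) : tanh a ^ 2 < tanh b ^ 2 := by
  have h₁ := sinh_pos_iff.2 ha
  have h₂ := sinh_lt_sinh.2 hab
  rw [tanh_eq_sinh_div_cosh, tanh_eq_sinh_div_cosh, div_pow, div_pow, cosh_sq, cosh_sq,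
    div_lt_div_iff₀ (by positivity) (by positivity)]
  nlinarith

lemma rowGap_pos_iff_and_neg_iff {n : ℕ} (hn : 2 ≤ n) {a b : ℝ} (ha : 0 < a) (hb : 0 < b)
    (hzero : rowGap n a = 0) : (0 < rowGap n b ↔ b < a) ∧ (rowGap n b < 0 ↔ a < b) := by
  obtain ⟨k, rfl⟩ := Nat.exists_eq_add_of_le' hn
  have hanti : ∀ {c d : ℝ}, 0 < c → c < d →
      tanhRatio (k + 2 + 1) (tanh d ^ 2) + tanhRatio (k + 2) (tanh d ^ 2) <
        tanhRatio (k + 2 + 1) (tanh c ^ 2) + tanhRatio (k + 2) (tanh c ^ 2) := by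
    intro c d hc hcd
    have ht := tanh_sq_lt_tanh_sq hc hcd
    have h₁ : tanh d ^ 2 < 1 := by
      rw [tanh_eq_sinh_div_cosh, div_pow, cosh_sq, div_lt_one (by positivity)]
      linarith
    exact add_lt_add (tanhRatio_lt (sq_nonneg _) ht h₁ (k + 1)) (tanhRatio_lt (sq_nonneg _) ht h₁ k)
  have hfac : ∀ {c : ℝ}, 0 < c →
      0 < sinh c * cosh ((k + 2 + 1 : ℕ) * c) * cosh ((k + 2 : ℕ) * c) := fun hc =>
    mul_pos (mul_pos (sinh_pos_iff.2 hc) (cosh_pos _)) (cosh_pos _)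
  rw [rowGap_eq, mul_eq_zero, or_iff_left (hfac ha).ne'] at hzero
  rw [rowGap_eq, mul_pos_iff_of_pos_right (hfac hb), ← not_le (a := (0 : ℝ)),
    mul_nonneg_iff_of_pos_right (hfac hb), not_le]
  rcases lt_trichotomy a b with h | rfl | h
  · have := hanti ha h
    exact ⟨⟨fun _ => by linarith, fun _ => by linarith⟩, ⟨fun _ => h, fun _ => by linarith⟩⟩
  · rw [hzero]; simp
  · have := hanti hb h
    exact ⟨⟨fun _ => h, fun _ => by linarith⟩, ⟨fun _ => by linarith, fun _ => by linarith⟩⟩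

lemma sum_triMat_mul {m : ℕ} (f : ℕ → ℝ) (h0 : f 0 = 0) (hm : f (m + 1) = 0) (i : Fin m) :
    ∑ k, triMat m i k * f (k + 1) = f i + f (i + 2) := by
  obtain ⟨i, hi⟩ := i
  have h₁ : ∀ k : Fin m, triMat m ⟨i, hi⟩ k * f (k + 1) =
      (fun k : ℕ => (if k = i + 1 then f (k + 1) else 0) +
        (if k + 1 = i then f (k + 1) else 0)) k := by
    rintro ⟨k, hk⟩
    simp only [triMat]
    split_ifs <;> first | omega | simp
  rw [Finset.sum_congr rfl fun k _ => h₁ k, Fin.sum_univ_eq_sum_range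
    (fun k : ℕ => (if k = i + 1 then f (k + 1) else 0) + (if k + 1 = i then f (k + 1) else 0)),
    Finset.sum_add_distrib, Finset.sum_ite_eq', add_comm]
  congr 1
  · cases i with
    | zero => simp [h0]
    | succ i =>
      simp only [Nat.add_right_cancel_iff, Finset.sum_ite_eq', Finset.mem_range]
      rw [if_pos (by omega)]
  · split_ifs with h
    · rfl
    · have : i + 2 = m + 1 := by rw [Finset.mem_range] at h; omega
      rw [this, hm]

/-- The matrix inverted in the Crank–Nicolson matrix. -/
def implicitMat (m : ℕ) (s : ℝ) : Matrix (Fin m) (Fin m) ℝ :=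
  (1 + s) • (1 : Matrix (Fin m) (Fin m) ℝ) - (s / 2) • triMat m

lemma sum_implicitMat_mul {m : ℕ} (s : ℝ) (f : ℕ → ℝ) (h0 : f 0 = 0) (hm : f (m + 1) = 0)
    (i : Fin m) :
    ∑ k, implicitMat m s i k * f (k + 1) = (1 + s) * f (i + 1) - s / 2 * (f i + f (i + 2)) := by
  rw [← sum_triMat_mul f h0 hm i]
  simp [implicitMat, sub_mul, Finset.sum_sub_distrib, Finset.mul_sum, Matrix.one_apply, mul_assoc]

/-- The entries of the inverse of `implicitMat m s` for `s = 1 / (2 * sinh h ^ 2)`, with indices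
starting at one, extended by zero to the boundary. -/
def green (m : ℕ) (h : ℝ) (j k : ℕ) : ℝ :=
  4 * sinh h ^ 2 / (sinh (2 * h) * sinh ((m + 1) * (2 * h))) *
    if k ≤ j then sinh (k * (2 * h)) * sinh ((m + 1 - j) * (2 * h))
    else sinh (j * (2 * h)) * sinh ((m + 1 - k) * (2 * h))

lemma green_nonneg {m : ℕ} {h : ℝ} (hh : 0 < h) {j k : ℕ} (hj : j ≤ m + 1) (hk : k ≤ m + 1) :
    0 ≤ green m h j k := by
  have hs : ∀ {x : ℝ}, 0 ≤ x → 0 ≤ sinh (x * (2 * h)) := fun hx =>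
    sinh_nonneg_iff.2 (by positivity)
  have hj' : (0 : ℝ) ≤ m + 1 - j := by rw [sub_nonneg]; exact_mod_cast hj
  have hk' : (0 : ℝ) ≤ m + 1 - k := by rw [sub_nonneg]; exact_mod_cast hk
  have h₁ : 0 ≤ sinh (2 * h) := sinh_nonneg_iff.2 (by positivity)
  have h₂ : 0 ≤ sinh (((m : ℝ) + 1) * (2 * h)) := hs (by positivity)
  unfold green
  refine mul_nonneg (by positivity) ?_
  split_ifs
  · exact mul_nonneg (hs k.cast_nonneg) (hs hj')
  · exact mul_nonneg (hs j.cast_nonneg) (hs hk')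

lemma sinh_sub_add_sinh_add (a b : ℝ) : sinh (a - b) + sinh (a + b) = 2 * cosh b * sinh a := by
  rw [sinh_add, sinh_sub]; ring

lemma green_recurrence {m : ℕ} {h : ℝ} (hh : 0 < h) (j i : ℕ) :
    green m h j i + green m h j (i + 2) = 2 * cosh (2 * h) * green m h j (i + 1) -
      if j = i + 1 then 4 * sinh h ^ 2 else 0 := by
  have h₁ : 0 < sinh (2 * h) := sinh_pos_iff.2 (by positivity)
  have h₂ : 0 < sinh (((m : ℝ) + 1) * (2 * h)) := sinh_pos_iff.2 (by positivity)
  unfold green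
  rcases lt_trichotomy j (i + 1) with hj | rfl | hj
  · have e := sinh_sub_add_sinh_add ((m + 1 - (i + 1 : ℕ)) * (2 * h)) (2 * h)
    rw [show ((m : ℝ) + 1 - (i + 1 : ℕ)) * (2 * h) - 2 * h = (m + 1 - (i + 2 : ℕ)) * (2 * h) by
        push_cast; ring,
      show ((m : ℝ) + 1 - (i + 1 : ℕ)) * (2 * h) + 2 * h = (m + 1 - i) * (2 * h) by
        push_cast; ring] at e
    have hi : (if i ≤ j then sinh (i * (2 * h)) * sinh ((m + 1 - j) * (2 * h))
        else sinh (j * (2 * h)) * sinh ((m + 1 - i) * (2 * h))) =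
        sinh (j * (2 * h)) * sinh ((m + 1 - i) * (2 * h)) := by
      split_ifs
      · obtain rfl : i = j := by omega
        rfl
      · rfl
    rw [hi, if_neg (by omega), if_neg (by omega), if_neg (by omega)]
    linear_combination (4 * sinh h ^ 2 / (sinh (2 * h) * sinh ((m + 1) * (2 * h)))) *
      sinh (j * (2 * h)) * e
  · rw [if_pos (by omega), if_neg (by omega), if_pos (by omega), if_pos rfl]
    have key : sinh (i * (2 * h)) * sinh ((m + 1 - (i + 1 : ℕ)) * (2 * h)) +
        sinh ((i + 1 : ℕ) * (2 * h)) * sinh ((m + 1 - (i + 2 : ℕ)) * (2 * h)) =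
        2 * cosh (2 * h) * (sinh ((i + 1 : ℕ) * (2 * h)) *
          sinh ((m + 1 - (i + 1 : ℕ)) * (2 * h))) -
        sinh (2 * h) * sinh ((m + 1) * (2 * h)) := by
      rw [show (i : ℝ) * (2 * h) = (i + 1 : ℕ) * (2 * h) - 2 * h by push_cast; ring,
        show ((m : ℝ) + 1 - (i + 2 : ℕ)) * (2 * h) = (m + 1 - (i + 1 : ℕ)) * (2 * h) - 2 * h by
          push_cast; ring,
        show ((m : ℝ) + 1) * (2 * h) = (i + 1 : ℕ) * (2 * h) + (m + 1 - (i + 1 : ℕ)) * (2 * h) by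
          push_cast; ring,
        sinh_sub, sinh_sub, sinh_add]
      ring
    rw [← mul_add, key]
    field_simp
  · have e := sinh_sub_add_sinh_add ((i + 1 : ℕ) * (2 * h)) (2 * h)
    rw [show ((i + 1 : ℕ) : ℝ) * (2 * h) - 2 * h = i * (2 * h) by push_cast; ring,
      show ((i + 1 : ℕ) : ℝ) * (2 * h) + 2 * h = (i + 2 : ℕ) * (2 * h) by push_cast; ring] at e
    rw [if_pos (by omega), if_pos (by omega), if_pos (by omega), if_neg (by omega)]
    linear_combination (4 * sinh h ^ 2 / (sinh (2 * h) * sinh ((m + 1) * (2 * h)))) *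
      sinh ((m + 1 - j) * (2 * h)) * e

lemma cosh_two_mul_eq (h : ℝ) : cosh (2 * h) = 1 + 2 * sinh h ^ 2 := by
  rw [cosh_two_mul, cosh_sq]; ring

lemma implicitMat_mul_green {m : ℕ} {h s : ℝ} (hh : 0 < h) (hs : s * (2 * sinh h ^ 2) = 1) :
    implicitMat m s * Matrix.of (fun i j : Fin m => green m h (j + 1) (i + 1)) = 1 := by
  ext i j
  rw [Matrix.mul_apply]
  simp only [Matrix.of_apply]
  rw [sum_implicitMat_mul s (green m h (j + 1)) (by simp [green])
    (by simp [green, show ¬ m ≤ (j : ℕ) by omega]), green_recurrence hh, cosh_two_mul_eq,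
    Matrix.one_apply]
  by_cases hij : i = j
  · subst hij
    rw [if_pos rfl, if_pos rfl]
    linear_combination (1 - green m h (i + 1) (i + 1)) * hs
  · rw [if_neg (by rw [Nat.add_right_cancel_iff]; exact fun h => hij (Fin.ext h.symm)),
      if_neg hij]
    linear_combination (-green m h (j + 1) (i + 1)) * hs

/-- The row sums of the inverse of `implicitMat`, extended by zero to the boundary. -/
def greenSum (m : ℕ) (h : ℝ) (k : ℕ) : ℝ :=
  1 - cosh ((m + 1 - 2 * k) * h) / cosh ((m + 1) * h)

lemma greenSum_recurrence (m : ℕ) (h : ℝ) (i : ℕ) :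
    greenSum m h i + greenSum m h (i + 2) =
      2 * cosh (2 * h) * greenSum m h (i + 1) - 4 * sinh h ^ 2 := by
  have hc := cosh_pos ((m + 1) * h)
  unfold greenSum
  rw [show ((m : ℝ) + 1 - 2 * i) * h = (m + 1 - 2 * (i + 1 : ℕ)) * h + 2 * h by push_cast; ring,
    show ((m : ℝ) + 1 - 2 * (i + 2 : ℕ)) * h = (m + 1 - 2 * (i + 1 : ℕ)) * h - 2 * h by
      push_cast; ring, cosh_add, cosh_sub, cosh_two_mul_eq]
  field_simp
  ring

lemma sum_green {m : ℕ} {h s : ℝ} (hh : 0 < h) (hs : s * (2 * sinh h ^ 2) = 1) (i : Fin m) :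
    ∑ j : Fin m, green m h (j + 1) (i + 1) = greenSum m h (i + 1) := by
  have hc := cosh_pos ((m + 1) * h)
  have hw : implicitMat m s *ᵥ (fun k : Fin m => greenSum m h (k + 1)) = fun _ => 1 := by
    ext k
    rw [Matrix.mulVec, dotProduct]
    rw [sum_implicitMat_mul s (greenSum m h) (by simp [greenSum, hc.ne']), greenSum_recurrence,
      cosh_two_mul_eq]
    · linear_combination (1 - greenSum m h (k + 1)) * hs
    · have : ((m : ℝ) + 1 - 2 * (m + 1 : ℕ)) * h = -((m + 1) * h) := by push_cast; ring
      rw [greenSum, this, cosh_neg, div_self hc.ne', sub_self]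
  have := congrFun (congrArg
    (fun v => Matrix.of (fun i j : Fin m => green m h (j + 1) (i + 1)) *ᵥ v) hw) i
  simp only [Matrix.mulVec_mulVec, mul_eq_one_comm.1 (implicitMat_mul_green hh hs),
    Matrix.one_mulVec] at this
  rw [this]
  simp [Matrix.mulVec, dotProduct]

lemma cnMat_apply {m : ℕ} {h s : ℝ} (hh : 0 < h) (hs : s * (2 * sinh h ^ 2) = 1) (i j : Fin m) :
    cnMat m s i j = 2 * green m h (j + 1) (i + 1) - if i = j then 1 else 0 := by
  have hinv := implicitMat_mul_green (m := m) hh hs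
  have hN : (1 - s) • (1 : Matrix (Fin m) (Fin m) ℝ) + (s / 2) • triMat m =
      (2 : ℝ) • (1 : Matrix (Fin m) (Fin m) ℝ) - implicitMat m s := by
    unfold implicitMat
    module
  rw [cnMat, hN, ← implicitMat, Matrix.inv_eq_right_inv hinv, mul_sub, mul_eq_one_comm.1 hinv]
  simp [Matrix.one_apply]

lemma sum_abs_cnMat_le_one_iff {m : ℕ} {h s : ℝ} (hh : 0 < h) (hs : s * (2 * sinh h ^ 2) = 1)
    (i : Fin m) :
    ∑ j, |cnMat m s i j| ≤ 1 ↔ greenSum m h (i + 1) ≤ 2 * green m h (i + 1) (i + 1) := by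
  have hterm : ∀ j : Fin m, |cnMat m s i j| = 2 * green m h (j + 1) (i + 1) +
      if i = j then |2 * green m h (i + 1) (i + 1) - 1| - 2 * green m h (i + 1) (i + 1) else 0 := by
    intro j
    rw [cnMat_apply hh hs]
    split_ifs with hij
    · subst hij; ring
    · rw [sub_zero, add_zero, abs_of_nonneg]
      exact mul_nonneg two_pos.le (green_nonneg hh (by omega) (by omega))
  have hle : greenSum m h (i + 1) ≤ 1 := by
    rw [greenSum, sub_le_self_iff]
    exact (div_pos (cosh_pos _) (cosh_pos _)).le
  rw [Finset.sum_congr rfl fun j _ => hterm j, Finset.sum_add_distrib, ← Finset.mul_sum,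
    sum_green hh hs, Finset.sum_ite_eq, if_pos (Finset.mem_univ i)]
  rcases abs_cases (2 * green m h (i + 1) (i + 1) - 1) with ⟨e, _⟩ | ⟨e, _⟩ <;> rw [e] <;>
    constructor <;> intro <;> linarith

lemma greenSum_le_iff {m : ℕ} {h : ℝ} (hh : 0 < h) (i : Fin m) :
    greenSum m h (i + 1) ≤ 2 * green m h (i + 1) (i + 1) ↔
      cosh h * sinh ((m + 1) * h) ≤
        2 * sinh h * (cosh ((m + 1) * h) + cosh ((m + 1 - 2 * (i + 1 : ℕ)) * h)) := by
  have hi : (i : ℝ) + 1 ≤ m := by exact_mod_cast i.2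
  have ha : 0 < ((i : ℕ) + 1 : ℝ) * h := by positivity
  have hb : 0 < (m - i : ℝ) * h := mul_pos (by linarith) hh
  have hsh := sinh_pos_iff.2 hh
  have hch := cosh_pos h
  have hsa := sinh_pos_iff.2 ha
  have hsb := sinh_pos_iff.2 hb
  have hsN := sinh_pos_iff.2 (add_pos ha hb)
  have hcN := cosh_pos (((i : ℕ) + 1 : ℝ) * h + (m - i : ℝ) * h)
  have e : greenSum m h (i + 1) - 2 * green m h (i + 1) (i + 1) =
      (cosh h * sinh ((m + 1) * h) -
        2 * sinh h * (cosh ((m + 1) * h) + cosh ((m + 1 - 2 * (i + 1 : ℕ)) * h))) *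
      (2 * sinh (((i : ℕ) + 1 : ℝ) * h) * sinh ((m - i : ℝ) * h) /
        (cosh h * sinh ((m + 1) * h) * cosh ((m + 1) * h))) := by
    rw [greenSum, green, if_pos le_rfl,
      show ((m : ℝ) + 1) * (2 * h) = 2 * (((i : ℕ) + 1 : ℝ) * h + (m - i : ℝ) * h) by ring,
      show ((m : ℝ) + 1) * h = ((i : ℕ) + 1 : ℝ) * h + (m - i : ℝ) * h by ring,
      show ((m : ℝ) + 1 - 2 * ((i + 1 : ℕ) : ℝ)) * h =
        (m - i : ℝ) * h - ((i : ℕ) + 1 : ℝ) * h by push_cast; ring,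
      show (((i : ℕ) + 1 : ℕ) : ℝ) * (2 * h) = 2 * (((i : ℕ) + 1 : ℝ) * h) by push_cast; ring,
      show ((m : ℝ) + 1 - ((i + 1 : ℕ) : ℝ)) * (2 * h) = 2 * ((m - i : ℝ) * h) by
        push_cast; ring]
    generalize (((i : ℕ) : ℝ) + 1) * h = a at *
    generalize ((m : ℝ) - (i : ℕ)) * h = b at *
    simp only [sinh_two_mul]
    field_simp
    simp only [sinh_add, cosh_add, cosh_sub]
    ring
  have hpos : 0 < 2 * sinh (((i : ℕ) + 1 : ℝ) * h) * sinh ((m - i : ℝ) * h) /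
        (cosh h * sinh ((m + 1) * h) * cosh ((m + 1) * h)) := by
    rw [show ((m : ℝ) + 1) * h = ((i : ℕ) + 1 : ℝ) * h + (m - i : ℝ) * h by ring]
    positivity
  rw [← sub_nonpos, e, ← sub_nonpos (a := cosh h * _), ← not_lt, ← not_lt,
    mul_pos_iff_of_pos_right hpos]

lemma maxNorm_cnMat_le_one_iff {n : ℕ} (hn : 0 < n) {h s : ℝ} (hh : 0 < h)
    (hs : s * (2 * sinh h ^ 2) = 1) : maxNorm (cnMat (n + n) s) ≤ 1 ↔ rowGap n h ≤ 0 := by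
  have : Nonempty (Fin (n + n)) := ⟨⟨0, by omega⟩⟩
  rw [maxNorm, ciSup_le_iff (Set.finite_range _).bddAbove, rowGap, sub_nonpos]
  simp only [sum_abs_cnMat_le_one_iff hh hs, greenSum_le_iff hh]
  rw [show ((n + n : ℕ) : ℝ) + 1 = 2 * n + 1 by push_cast; ring]
  constructor
  · intro H
    have := H ⟨n - 1, by omega⟩
    rwa [Nat.sub_add_cancel hn, show (2 * (n : ℝ) + 1 - 2 * n) * h = h by ring] at this
  · intro H i
    refine H.trans (mul_le_mul_of_nonneg_left ?_ ?_)
    · rw [add_le_add_iff_left, cosh_le_cosh, abs_mul]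
      refine le_mul_of_one_le_left (abs_nonneg h) ?_
      have : (1 : ℤ) ≤ |2 * (n : ℤ) + 1 - 2 * ((i + 1 : ℕ) : ℤ)| := Int.one_le_abs (by omega)
      exact_mod_cast this
    · have := sinh_pos_iff.2 hh
      positivity

theorem stmt6 (m : ℕ) (hm : 4 ≤ m) (heven : Even m) :
    ∃ ω : ℝ, 0 < ω ∧ evenEq m ω ∧
      (∀ ω' : ℝ, 0 < ω' → evenEq m ω' → ω' = ω) ∧
      ∀ s : ℝ, 0 < s →
        (maxNorm (cnMat m s) ≤ 1 ↔ s ≤ 1 / (Real.cosh ω - 1)) := by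
  obtain ⟨n, rfl⟩ := heven
  have hn : 2 ≤ n := by omega
  obtain ⟨a, ha, hzero⟩ := exists_rowGap_eq_zero hn
  have hsa := sinh_pos_iff.2 ha
  refine ⟨2 * a, by positivity, (evenEq_iff_rowGap hn ha).2 hzero, fun ω hω hev => ?_,
    fun s hs => ?_⟩
  · have hb : 0 < ω / 2 := by positivity
    rw [show ω = 2 * (ω / 2) by ring, evenEq_iff_rowGap hn hb] at hev
    obtain ⟨h₁, h₂⟩ := rowGap_pos_iff_and_neg_iff hn ha hb hzero
    rw [hev] at h₁ h₂
    have h₃ := not_lt.1 (mt h₁.2 (lt_irrefl 0))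
    have h₄ := not_lt.1 (mt h₂.2 (lt_irrefl 0))
    linarith
  · have hd : 0 < 1 / (2 * s) := by positivity
    have hb : 0 < arsinh √(1 / (2 * s)) := arsinh_pos_iff.2 (sqrt_pos.2 hd)
    have hsb : s * (2 * sinh (arsinh √(1 / (2 * s))) ^ 2) = 1 := by
      rw [sinh_arsinh, sq_sqrt hd.le]
      field_simp
    rw [maxNorm_cnMat_le_one_iff (by omega) hb hsb, ← not_lt,
      (rowGap_pos_iff_and_neg_iff hn ha hb hzero).1, not_lt, ← arsinh_sinh a, arsinh_le_arsinh,
      arsinh_sinh, le_sqrt hsa.le, cosh_two_mul_eq, le_div_iff₀ (by positivity),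
      le_div_iff₀ (by ring_nf; positivity)]
    · constructor <;> intro <;> linarith
    · exact hd.le
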